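/- Let H be a linearly ordered group with strong unit u > 0 and let M = Γ(K,v) be a strongly (H,u)-perfect pseudo MV-algebra. Then there exists a (not necessarily abelian) ℓ-group G such that M is isomorphic, as a pseudo MV-algebra, to Γ(H ×lex G, (u,0)). -/

import Mathlib

universe uK

/-- `v` is a strong (order) unit of an ordered group: `v ≥ 0` and every element is
dominated by some positive multiple of `v`. -/
def IsStrongOrderUnit {G : Type*} [AddMonoid G] [PartialOrder G] (v : G) : Prop :=
  0 ≤ v ∧ ∀ g : G, ∃ n : ℕ, 0 < n ∧ g ≤ n • v

section LexDefs

variable {H G : Type*}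

/-- The lexicographic order on the product `H × G`:
`(h,g) ≤ (h',g')` iff `h < h'` or (`h = h'` and `g ≤ g'`). -/
def lexLe [LT H] [LE G] (p q : H × G) : Prop :=
  p.1 < q.1 ∨ (p.1 = q.1 ∧ p.2 ≤ q.2)

/-- The meet in the lexicographic product of a linear order with a lattice. -/
def lexInf [LinearOrder H] [Lattice G] (p q : H × G) : H × G :=
  if p.1 < q.1 then p else if q.1 < p.1 then q else (p.1, p.2 ⊓ q.2)

end LexDefs

section Decomposition

variable {H : Type*} [AddGroup H] [LinearOrder H]
  [CovariantClass H H (· + ·) (· ≤ ·)]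
  [CovariantClass H H (Function.swap (· + ·)) (· ≤ ·)]
variable {K : Type uK} [AddGroup K] [Lattice K]
  [CovariantClass K K (· + ·) (· ≤ ·)]
  [CovariantClass K K (Function.swap (· + ·)) (· ≤ ·)]

/-- An `(H,u)`-decomposition of the pseudo MV-algebra `M = Γ(K,v)`. -/
structure IsHuDecomposition (u : H) (v : K) (Mt : H → Set K) : Prop where
  nonempty : ∀ t ∈ Set.Icc (0 : H) u, (Mt t).Nonempty
  subset_carrier : ∀ t ∈ Set.Icc (0 : H) u, Mt t ⊆ Set.Icc (0 : K) v
  pairwise_disjoint : ∀ s ∈ Set.Icc (0 : H) u, ∀ t ∈ Set.Icc (0 : H) u,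
    s ≠ t → Disjoint (Mt s) (Mt t)
  cover : ∀ x ∈ Set.Icc (0 : K) v, ∃ t ∈ Set.Icc (0 : H) u, x ∈ Mt t
  le_of_lt : ∀ s ∈ Set.Icc (0 : H) u, ∀ t ∈ Set.Icc (0 : H) u, s < t →
    ∀ a ∈ Mt s, ∀ b ∈ Mt t, a ≤ b
  compl_image : ∀ t ∈ Set.Icc (0 : H) u, (fun x => v - x) '' Mt t = Mt (u - t)
  sim_image : ∀ t ∈ Set.Icc (0 : H) u, (fun x => -x + v) '' Mt t = Mt (-t + u)
  oplus_mem : ∀ s ∈ Set.Icc (0 : H) u, ∀ t ∈ Set.Icc (0 : H) u,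
    ∀ x ∈ Mt s, ∀ y ∈ Mt t, (x + y) ⊓ v ∈ Mt (min (s + t) u)

/-- The convex subgroup of the elements lying between `-a` and `a` for some `a` in a submonoid
`P` of nonnegative elements. -/
def AddSubmonoid.convexSubgroup (P : AddSubmonoid K) (hP : ∀ a ∈ P, 0 ≤ a) : AddSubgroup K where
  carrier := {g | ∃ a ∈ P, -a ≤ g ∧ g ≤ a}
  zero_mem' := ⟨0, P.zero_mem, by simp⟩
  neg_mem' := by
    rintro g ⟨a, ha, h₁, h₂⟩
    exact ⟨a, ha, neg_le_neg_iff.mpr h₂, _root_.neg_le.mp h₁⟩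
  add_mem' := by
    rintro g h ⟨a, ha, hga, hag⟩ ⟨b, hb, hhb, hbh⟩
    refine ⟨a + b + a, P.add_mem (P.add_mem ha hb) ha, ?_, ?_⟩
    · calc -(a + b + a) = -a + -b + -a := by simp [neg_add_rev, add_assoc]
        _ ≤ -a + -b := add_le_of_nonpos_right (neg_nonpos.mpr (hP a ha))
        _ ≤ g + h := add_le_add hga hhb
    · exact (add_le_add hag hbh).trans (le_add_of_nonneg_right (hP a ha))

lemma AddSubmonoid.sup_mem_convexSubgroup {P : AddSubmonoid K} {hP : ∀ a ∈ P, 0 ≤ a} {g h : K}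
    (hg : g ∈ P.convexSubgroup hP) (hh : h ∈ P.convexSubgroup hP) :
    g ⊔ h ∈ P.convexSubgroup hP := by
  obtain ⟨a, ha, hga, hag⟩ := hg
  obtain ⟨b, hb, -, hbh⟩ := hh
  refine ⟨a + b, P.add_mem ha hb, ?_, sup_le ?_ ?_⟩
  · exact (neg_le_neg_iff.mpr (le_add_of_nonneg_right (hP b hb))).trans (hga.trans le_sup_left)
  · exact hag.trans (le_add_of_nonneg_right (hP b hb))
  · exact hbh.trans (le_add_of_nonneg_left (hP a ha))

lemma AddSubmonoid.inf_mem_convexSubgroup {P : AddSubmonoid K} {hP : ∀ a ∈ P, 0 ≤ a} {g h : K}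
    (hg : g ∈ P.convexSubgroup hP) (hh : h ∈ P.convexSubgroup hP) :
    g ⊓ h ∈ P.convexSubgroup hP := by
  have := neg_mem (sup_mem_convexSubgroup (neg_mem hg) (neg_mem hh))
  rwa [_root_.neg_sup, neg_neg, neg_neg] at this

lemma sub_mem_Icc_zero {u t : H} (ht : t ∈ Set.Icc 0 u) : u - t ∈ Set.Icc 0 u :=
  ⟨sub_nonneg.mpr ht.2, sub_le_self u ht.1⟩

lemma neg_add_mem_Icc_zero {u t : H} (ht : t ∈ Set.Icc 0 u) : -t + u ∈ Set.Icc 0 u :=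
  ⟨by simpa using ht.2, by simpa using ht.1⟩

namespace IsHuDecomposition

set_option linter.unusedSectionVars false

variable {u : H} {v : K} {Mt : H → Set K}

lemma index_unique (h : IsHuDecomposition u v Mt) {s t : H} (hs : s ∈ Set.Icc 0 u)
    (ht : t ∈ Set.Icc 0 u) {x : K} (hxs : x ∈ Mt s) (hxt : x ∈ Mt t) : s = t := by
  by_contra hne
  exact Set.disjoint_left.mp (h.pairwise_disjoint s hs t ht hne) hxs hxt

lemma sub_mem (h : IsHuDecomposition u v Mt) {t : H} (ht : t ∈ Set.Icc 0 u) {x : K}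
    (hx : x ∈ Mt t) : v - x ∈ Mt (u - t) :=
  h.compl_image t ht ▸ Set.mem_image_of_mem _ hx

lemma neg_add_mem (h : IsHuDecomposition u v Mt) {t : H} (ht : t ∈ Set.Icc 0 u) {x : K}
    (hx : x ∈ Mt t) : -x + v ∈ Mt (-t + u) :=
  h.sim_image t ht ▸ Set.mem_image_of_mem _ hx

lemma mem_of_sub_mem (h : IsHuDecomposition u v Mt) {t : H} (ht : t ∈ Set.Icc 0 u) {x : K}
    (hx : v - x ∈ Mt (u - t)) : x ∈ Mt t := by
  rw [← h.compl_image t ht] at hx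
  obtain ⟨z, hz, hzx⟩ := hx
  rwa [← sub_right_injective hzx]

lemma add_le_of_lt (h : IsHuDecomposition u v Mt) {s t : H} (hs : s ∈ Set.Icc 0 u)
    (ht : t ∈ Set.Icc 0 u) (hst : s + t < u) {x y : K} (hx : x ∈ Mt s) (hy : y ∈ Mt t) :
    x + y ≤ v :=
  le_sub_iff_add_le.mp <|
    h.le_of_lt s hs _ (sub_mem_Icc_zero ht) (lt_sub_iff_add_lt.mpr hst) x hx _ (h.sub_mem ht hy)

lemma le_add_of_lt (h : IsHuDecomposition u v Mt) {s t : H} (hs : s ∈ Set.Icc 0 u)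
    (ht : t ∈ Set.Icc 0 u) (hst : u < s + t) {x y : K} (hx : x ∈ Mt s) (hy : y ∈ Mt t) :
    v ≤ x + y :=
  sub_le_iff_le_add.mp <|
    h.le_of_lt _ (sub_mem_Icc_zero ht) s hs (sub_lt_iff_lt_add.mpr hst) _ (h.sub_mem ht hy) x hx

lemma add_mem_of_lt (h : IsHuDecomposition u v Mt) {s t : H} (hs : s ∈ Set.Icc 0 u)
    (ht : t ∈ Set.Icc 0 u) (hst : s + t < u) {x y : K} (hx : x ∈ Mt s) (hy : y ∈ Mt t) :
    x + y ∈ Mt (s + t) := by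
  have := h.oplus_mem s hs t ht x hx y hy
  rwa [inf_eq_left.mpr (h.add_le_of_lt hs ht hst hx hy), min_eq_left hst.le] at this

/-- The summand of index `0` is closed downwards among nonnegative elements. -/
lemma mem_zero_of_le (h : IsHuDecomposition u v Mt) (hu : 0 < u) {x a : K} (hx : 0 ≤ x)
    (ha : a ∈ Mt 0) (hxa : x ≤ a) : x ∈ Mt 0 := by
  have h0 : (0 : H) ∈ Set.Icc 0 u := ⟨le_rfl, hu.le⟩
  obtain ⟨t, ht, hxt⟩ := h.cover x ⟨hx, hxa.trans (h.subset_carrier 0 h0 ha).2⟩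
  rcases ht.1.eq_or_lt with rfl | htpos
  · exact hxt
  · rwa [hxa.antisymm (h.le_of_lt 0 h0 t ht htpos a ha x hxt)]

lemma nonneg_of_mem_zero (h : IsHuDecomposition u v Mt) (hu : 0 < u) {a : K} (ha : a ∈ Mt 0) :
    0 ≤ a :=
  (h.subset_carrier 0 ⟨le_rfl, hu.le⟩ ha).1

lemma posPart_sub_mem_zero (h : IsHuDecomposition u v Mt) {t : H} (ht : t ∈ Set.Icc 0 u)
    {x y : K} (hx : x ∈ Mt t) (hy : y ∈ Mt t) : (x - y) ⊔ 0 ∈ Mt 0 := by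
  have hmem := h.oplus_mem t ht _ (neg_add_mem_Icc_zero ht) y hy _ (h.neg_add_mem ht hx)
  rw [add_neg_cancel_left, min_self] at hmem
  have := h.sub_mem ⟨ht.1.trans ht.2, le_rfl⟩ hmem
  rw [sub_self] at this
  convert this using 1
  rw [sub_eq_add_neg v, neg_inf, add_sup]
  simp [neg_add_rev, sub_eq_add_neg, ← add_assoc]

/-- The summand of index `0`, as a submonoid of the ambient group. -/
def zeroSubmonoid (h : IsHuDecomposition u v Mt) (hu : 0 < u) : AddSubmonoid K where
  carrier := Mt 0
  zero_mem' := by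
    obtain ⟨a, ha⟩ := h.nonempty 0 ⟨le_rfl, hu.le⟩
    exact h.mem_zero_of_le hu le_rfl ha (h.nonneg_of_mem_zero hu ha)
  add_mem' := by
    intro a b ha hb
    have h0 : (0 : H) ∈ Set.Icc 0 u := ⟨le_rfl, hu.le⟩
    simpa using h.add_mem_of_lt h0 h0 (by simpa using hu) ha hb

/-- The convex subgroup whose positive cone is the summand of index `0`. -/
def zeroSubgroup (h : IsHuDecomposition u v Mt) (hu : 0 < u) : AddSubgroup K :=
  (h.zeroSubmonoid hu).convexSubgroup fun _ ha => h.nonneg_of_mem_zero hu ha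

lemma mem_zero_of_mem_zeroSubgroup (h : IsHuDecomposition u v Mt) (hu : 0 < u) {g : K}
    (hg : g ∈ h.zeroSubgroup hu) (hg0 : 0 ≤ g) : g ∈ Mt 0 := by
  obtain ⟨a, ha, -, hga⟩ := hg
  exact h.mem_zero_of_le hu hg0 ha hga

lemma sub_mem_zeroSubgroup (h : IsHuDecomposition u v Mt) (hu : 0 < u) {t : H}
    (ht : t ∈ Set.Icc 0 u) {x y : K} (hx : x ∈ Mt t) (hy : y ∈ Mt t) :
    x - y ∈ h.zeroSubgroup hu := by
  have hxy := h.posPart_sub_mem_zero ht hx hy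
  have hyx := h.posPart_sub_mem_zero ht hy hx
  refine ⟨_, (h.zeroSubmonoid hu).add_mem hxy hyx, ?_, ?_⟩
  · rw [neg_le, neg_sub]
    exact le_sup_left.trans (le_add_of_nonneg_left le_sup_right)
  · exact le_sup_left.trans (le_add_of_nonneg_right le_sup_right)

/-- Strictly inside `[0,u]` the summands are invariant under translation by the subgroup
generated by the summand of index `0`. -/
lemma add_mem_of_mem_zeroSubgroup (h : IsHuDecomposition u v Mt) (hu : 0 < u) {t : H}
    (ht : 0 < t) (htu : t < u) {g x : K} (hg : g ∈ h.zeroSubgroup hu) (hx : x ∈ Mt t) :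
    g + x ∈ Mt t := by
  have h0 : (0 : H) ∈ Set.Icc 0 u := ⟨le_rfl, hu.le⟩
  have ht' : t ∈ Set.Icc 0 u := ⟨ht.le, htu.le⟩
  obtain ⟨b, hb, hbg, hgb⟩ := hg
  have hbg0 : b + g ∈ Mt 0 :=
    h.mem_zero_of_le hu (neg_le_iff_add_nonneg'.mp hbg)
      ((h.zeroSubmonoid hu).add_mem hb hb) (by gcongr)
  have hmem : b + g + x ∈ Mt t := by
    simpa using h.add_mem_of_lt h0 ht' (by simpa using htu) hbg0 hx
  have hsum := h.add_mem_of_lt (sub_mem_Icc_zero ht') h0 (by simpa using ht) (h.sub_mem ht' hmem) hb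
  rw [add_zero] at hsum
  refine h.mem_of_sub_mem ht' ?_
  convert hsum using 1
  simp [sub_eq_add_neg, neg_add_rev, add_assoc]

end IsHuDecomposition

/-- Every strongly `(H,u)`-perfect pseudo MV-algebra `M = Γ(K,v)`
(an `(H,u)`-decomposition `(Mt t)` together with elements `c t ∈ Mt t` with
`c (s+t) = c s + c t` for `s + t ≤ u`, `c u = v`,
`(x + y) - c (s+t) = (x - c s) + (y - c t)` for `x ∈ Mt s`, `y ∈ Mt t`, `s + t ≤ u`,
and `x - c t = -(c t) + x` for `x ∈ Mt t`) is isomorphic, as a pseudo MV-algebra,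
to `Γ(H ×lex G, (u,0))` for some (not necessarily abelian) ℓ-group `G`. -/
theorem statement_10 (u : H) (v : K) (hu : 0 < u)
    (hsuH : IsStrongOrderUnit u) (hsuK : IsStrongOrderUnit v)
    (Mt : H → Set K) (c : H → K)
    (hdec : IsHuDecomposition u v Mt)
    (hc_mem : ∀ t ∈ Set.Icc (0 : H) u, c t ∈ Mt t)
    (hc_add : ∀ s ∈ Set.Icc (0 : H) u, ∀ t ∈ Set.Icc (0 : H) u, s + t ≤ u →
      c (s + t) = c s + c t)
    (hc_u : c u = v)
    (hc_lex : ∀ s ∈ Set.Icc (0 : H) u, ∀ t ∈ Set.Icc (0 : H) u, s + t ≤ u →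
      ∀ x ∈ Mt s, ∀ y ∈ Mt t, (x + y) - c (s + t) = (x - c s) + (y - c t))
    (hc_comm : ∀ t ∈ Set.Icc (0 : H) u, ∀ x ∈ Mt t, x - c t = -(c t) + x) :
    ∃ (G : Type uK) (_ : AddGroup G) (_ : Lattice G),
      (∀ a b : G, a ≤ b → ∀ x y : G, x + a + y ≤ x + b + y) ∧
      ∃ φ : K → H × G,
        (∀ x ∈ Set.Icc (0 : K) v, lexLe (0 : H × G) (φ x) ∧ lexLe (φ x) ((u, 0) : H × G)) ∧
        (∀ x ∈ Set.Icc (0 : K) v, ∀ y ∈ Set.Icc (0 : K) v, φ x = φ y → x = y) ∧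
        (∀ p : H × G, lexLe 0 p → lexLe p ((u, 0) : H × G) →
          ∃ x ∈ Set.Icc (0 : K) v, φ x = p) ∧
        φ 0 = 0 ∧ φ v = ((u, 0) : H × G) ∧
        (∀ x ∈ Set.Icc (0 : K) v, ∀ y ∈ Set.Icc (0 : K) v,
          φ ((x + y) ⊓ v) = lexInf (φ x + φ y) ((u, 0) : H × G)) ∧
        (∀ x ∈ Set.Icc (0 : K) v, φ (v - x) = ((u, 0) : H × G) - φ x) ∧
        (∀ x ∈ Set.Icc (0 : K) v, φ (-x + v) = -(φ x) + ((u, 0) : H × G)) := by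
  have h0 : (0 : H) ∈ Set.Icc 0 u := ⟨le_rfl, hu.le⟩
  have huu : u ∈ Set.Icc 0 u := ⟨hu.le, le_rfl⟩
  have hc0 : c 0 = 0 := by
    simpa using hc_add 0 h0 0 h0 (by simpa using hu.le)
  let S := hdec.zeroSubgroup hu
  let latS : Lattice S := Subtype.lattice
    (fun _ _ => AddSubmonoid.sup_mem_convexSubgroup) (fun _ _ => AddSubmonoid.inf_mem_convexSubgroup)
  refine ⟨S, inferInstance, latS, ?_, ?_⟩
  · intro a b hab x y
    exact add_le_add_left (add_le_add_right (α := K) hab x) (y : K)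
  have hex : ∀ x : K, ∃ p : H × S, x ∈ Set.Icc 0 v →
      p.1 ∈ Set.Icc 0 u ∧ x ∈ Mt p.1 ∧ (p.2 : K) = x - c p.1 := by
    intro x
    by_cases hx : x ∈ Set.Icc 0 v
    · obtain ⟨t, ht, hxt⟩ := hdec.cover x hx
      exact ⟨(t, ⟨x - c t, hdec.sub_mem_zeroSubgroup hu ht hxt (hc_mem t ht)⟩),
        fun _ => ⟨ht, hxt, rfl⟩⟩
    · exact ⟨0, fun h => absurd h hx⟩
  choose φ hφ using hex
  have hφ_eq : ∀ x ∈ Set.Icc 0 v, ∀ p : H × S, p.1 ∈ Set.Icc 0 u → x ∈ Mt p.1 →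
      (p.2 : K) = x - c p.1 → φ x = p := by
    intro x hx p hp hxp hpc
    obtain ⟨hi, hm, he⟩ := hφ x hx
    have hidx := hdec.index_unique hi hp hm hxp
    refine Prod.ext hidx (Subtype.ext ?_)
    rw [he, hpc, hidx]
  refine ⟨φ, ?_, ?_, ?_, ?_, ?_, ?_, ?_, ?_⟩
  · intro x hx
    obtain ⟨hi, hm, he⟩ := hφ x hx
    constructor
    · rcases hi.1.eq_or_lt with h | h
      · refine Or.inr ⟨h, Subtype.coe_le_coe.mp ?_⟩
        rw [he, ← h, hc0, sub_zero]
        exact hx.1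
      · exact Or.inl h
    · rcases hi.2.eq_or_lt with h | h
      · refine Or.inr ⟨h, Subtype.coe_le_coe.mp ?_⟩
        rw [he, h, hc_u]
        exact sub_nonpos.mpr hx.2
      · exact Or.inl h
  · intro x hx y hy hxy
    have hxe := (hφ x hx).2.2
    rw [hxy, (hφ y hy).2.2] at hxe
    exact (sub_left_injective hxe).symm
  · rintro ⟨t, g⟩ hp₀ hp₁
    obtain ⟨ht, hmem⟩ : t ∈ Set.Icc 0 u ∧ (g : K) + c t ∈ Mt t := by
      rcases hp₀ with h | ⟨h, hg⟩
      · rcases hp₁ with h' | ⟨h', hg⟩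
        · exact ⟨⟨h.le, h'.le⟩, hdec.add_mem_of_mem_zeroSubgroup hu h h' g.2
            (hc_mem t ⟨h.le, h'.le⟩)⟩
        · change t = u at h'
          subst h'
          have hg' : (g : K) ≤ 0 := hg
          have := hdec.neg_add_mem h0 (hdec.mem_zero_of_mem_zeroSubgroup hu (neg_mem g.2)
            (neg_nonneg.mpr hg'))
          exact ⟨huu, by simpa [hc_u] using this⟩
      · change 0 = t at h
        subst h
        have hg' : (0 : K) ≤ g := hg
        exact ⟨h0, by simpa [hc0] using hdec.mem_zero_of_mem_zeroSubgroup hu g.2 hg'⟩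
    have hx := hdec.subset_carrier t ht hmem
    exact ⟨_, hx, hφ_eq _ hx _ ht hmem (by simp)⟩
  · exact hφ_eq 0 ⟨le_rfl, hsuK.1⟩ 0 h0 (by simpa [hc0] using hc_mem 0 h0) (by simp [hc0])
  · exact hφ_eq v ⟨hsuK.1, le_rfl⟩ (u, 0) huu (by simpa [hc_u] using hc_mem u huu) (by simp [hc_u])
  · intro x hx y hy
    obtain ⟨hix, hmx, hex⟩ := hφ x hx
    obtain ⟨hiy, hmy, hey⟩ := hφ y hy
    have hxy : (x + y) ⊓ v ∈ Set.Icc 0 v := ⟨le_inf (add_nonneg hx.1 hy.1) hsuK.1, inf_le_right⟩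
    have hmem := hdec.oplus_mem _ hix _ hiy x hmx y hmy
    have hpos : 0 ≤ (φ x).1 + (φ y).1 := add_nonneg hix.1 hiy.1
    rcases lt_trichotomy ((φ x).1 + (φ y).1) u with hlt | heq | hgt
    · rw [lexInf, if_pos (by exact hlt)]
      rw [min_eq_left hlt.le] at hmem
      refine hφ_eq _ hxy _ ⟨hpos, hlt.le⟩ hmem ?_
      rw [inf_eq_left.mpr (hdec.add_le_of_lt hix hiy hlt hmx hmy)]
      simp only [Prod.fst_add, Prod.snd_add, AddSubgroup.coe_add, hex, hey]
      exact (hc_lex _ hix _ hiy hlt.le x hmx y hmy).symm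
    · rw [lexInf, if_neg (by exact heq.not_lt), if_neg (by exact heq.not_gt)]
      refine hφ_eq _ hxy _ ⟨hpos, heq.le⟩ (by rwa [min_eq_left heq.le] at hmem) ?_
      change (((φ x).2 + (φ y).2 : S) : K) ⊓ 0 = (x + y) ⊓ v - c ((φ x).1 + (φ y).1)
      have hlex := hc_lex _ hix _ hiy heq.le x hmx y hmy
      rw [AddSubgroup.coe_add, hex, hey, ← hlex, heq, hc_u]
      simp only [sub_eq_add_neg, inf_add, add_neg_cancel]
    · rw [lexInf, if_neg (by exact hgt.not_gt), if_pos (by exact hgt)]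
      rw [inf_eq_right.mpr (hdec.le_add_of_lt hix hiy hgt hmx hmy)]
      exact hφ_eq v ⟨hsuK.1, le_rfl⟩ (u, 0) huu (by simpa [hc_u] using hc_mem u huu) (by simp [hc_u])
  · intro x hx
    obtain ⟨hi, hm, he⟩ := hφ x hx
    have hmem := hdec.sub_mem hi hm
    refine hφ_eq _ ⟨sub_nonneg.mpr hx.2, sub_le_self v hx.1⟩ _ (sub_mem_Icc_zero hi) hmem ?_
    have hlex := hc_lex _ (sub_mem_Icc_zero hi) _ hi (by simp) _ hmem x hm
    rw [sub_add_cancel, sub_add_cancel, hc_u, sub_self, ← he] at hlex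
    simpa using (eq_neg_of_add_eq_zero_left hlex.symm).symm
  · intro x hx
    obtain ⟨hi, hm, he⟩ := hφ x hx
    have hmem := hdec.neg_add_mem hi hm
    refine hφ_eq _ ⟨by simpa using hx.2, by simpa using hx.1⟩ _ (neg_add_mem_Icc_zero hi) hmem ?_
    have hlex := hc_lex _ hi _ (neg_add_mem_Icc_zero hi) (by simp) x hm _ hmem
    rw [add_neg_cancel_left, add_neg_cancel_left, hc_u, sub_self, ← he] at hlex
    simpa using (eq_neg_of_add_eq_zero_right hlex.symm).symm

end Decomposition
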